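/- Let α ∈ (1/3, 1/2], γ ∈ (α, 2α], and β ∈ [0,1] with βα + α ≥ γ. Let F : ℝ^{n₀} → ℝ^{n₁} be twice continuously differentiable with ‖F‖_{C¹} := sup|F| + sup‖DF‖ < ∞ and ‖F‖_{C²} := ‖F‖_{C¹} + sup‖D²F‖ < ∞, let g : [0,1] → ℝ^{d₀}, and let f : [0,1] → ℝ^{n₀}, f' : [0,1] → ℝ^{n₀×d₀} have finite controlled seminorm on [s,t] ⊆ [0,1]. Then, writing (DF∘f)f' for the path x ↦ DF(f(x))f'(x) ∈ ℝ^{n₁×d₀}, there exists a constant N depending only on α, γ, β such that [(F∘f, (DF∘f)f')]_{D^γ_g([s,t])} ≤ N ‖F‖_{C¹} (1 + ‖f'‖_{C⁰([s,t])}) [(f,f')]_{D^γ_g([s,t])} + N ‖F‖_{C²} ‖f'‖_{C⁰([s,t])} (1 + [g]_{C^α([s,t])}) ( [(f,f')]_{D^γ_g([s,t])}^β + [g]_{C^α([s,t])}^β ‖f'‖_{C⁰([s,t])}^β ). -/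

import Mathlib

open scoped ENNReal

/-- Frobenius (Euclidean) norm of a real matrix. -/
noncomputable def frobNorm {m n : ℕ} (M : Matrix (Fin m) (Fin n) ℝ) : ℝ :=
  Real.sqrt (∑ i, ∑ j, (M i j) ^ 2)

/-- Reinterpret a plain vector `ℝ^d` as a point of Euclidean space. -/
noncomputable def toEuc {d : ℕ} (v : Fin d → ℝ) : EuclideanSpace ℝ (Fin d) :=
  (WithLp.equiv 2 (Fin d → ℝ)).symm v

/-- Hölder seminorm `[h]_{C^β([s,t])}` of a vector-valued path (with value in
`[0,∞]`). -/
noncomputable def holderSemiE {E : Type*} [NormedAddCommGroup E] (β : ℝ)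
    (h : ℝ → E) (s t : ℝ) : ℝ≥0∞ :=
  ⨆ (u : ℝ) (v : ℝ) (_ : s ≤ u ∧ u < v ∧ v ≤ t),
    ENNReal.ofReal (‖h v - h u‖ / (v - u) ^ β)

/-- Hölder seminorm `[h]_{C^β([s,t])}` of a matrix-valued path, with respect to
the Frobenius norm (with value in `[0,∞]`). -/
noncomputable def holderSemiMat {m n : ℕ} (β : ℝ)
    (h : ℝ → Matrix (Fin m) (Fin n) ℝ) (s t : ℝ) : ℝ≥0∞ :=
  ⨆ (u : ℝ) (v : ℝ) (_ : s ≤ u ∧ u < v ∧ v ≤ t),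
    ENNReal.ofReal (frobNorm (h v - h u) / (v - u) ^ β)

/-- Supremum norm `‖h‖_{C⁰([s,t])}` of a matrix-valued path, with respect to the
Frobenius norm (with value in `[0,∞]`). -/
noncomputable def supNormMat {m n : ℕ}
    (h : ℝ → Matrix (Fin m) (Fin n) ℝ) (s t : ℝ) : ℝ≥0∞ :=
  ⨆ (r : ℝ) (_ : r ∈ Set.Icc s t), ENNReal.ofReal (frobNorm (h r))

/-- Controlled-path seminorm
`[(f,f')]_{D^γ_g([s,t])} = sup_{s ≤ u < v ≤ t} |f(v)-f(u)-f'(u)(g(v)-g(u))|/(v-u)^γ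
  + [f']_{C^{γ-α}([s,t])}` (with value in `[0,∞]`). -/
noncomputable def ctrlSemi {d₀ n : ℕ} (γ α : ℝ)
    (g : ℝ → EuclideanSpace ℝ (Fin d₀)) (f : ℝ → EuclideanSpace ℝ (Fin n))
    (f' : ℝ → Matrix (Fin n) (Fin d₀) ℝ) (s t : ℝ) : ℝ≥0∞ :=
  (⨆ (u : ℝ) (v : ℝ) (_ : s ≤ u ∧ u < v ∧ v ≤ t),
    ENNReal.ofReal (‖f v - f u - toEuc ((f' u).mulVec (g v - g u))‖ / (v - u) ^ γ))
    + holderSemiMat (γ - α) f' s t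

/-- The Jacobian matrix of `F : ℝ^{n₀} → ℝ^{n₁}` at `y`. -/
noncomputable def jacMat {n₀ n₁ : ℕ}
    (F : EuclideanSpace ℝ (Fin n₀) → EuclideanSpace ℝ (Fin n₁))
    (y : EuclideanSpace ℝ (Fin n₀)) : Matrix (Fin n₁) (Fin n₀) ℝ :=
  fun i j => fderiv ℝ F y (EuclideanSpace.single j 1) i

section Frobenius

variable {l m n : ℕ}

lemma frobNorm_nonneg (M : Matrix (Fin m) (Fin n) ℝ) : 0 ≤ frobNorm M :=
  Real.sqrt_nonneg _

lemma frobNorm_sq (M : Matrix (Fin m) (Fin n) ℝ) :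
    frobNorm M ^ 2 = ∑ i, ∑ j, M i j ^ 2 :=
  Real.sq_sqrt (Finset.sum_nonneg fun _ _ => Finset.sum_nonneg fun _ _ => sq_nonneg _)

attribute [local instance] Matrix.frobeniusNormedAddCommGroup in
lemma frobNorm_eq_norm (M : Matrix (Fin m) (Fin n) ℝ) : frobNorm M = ‖M‖ := by
  simp [frobNorm, Matrix.frobenius_norm_def, Real.sqrt_eq_rpow]

attribute [local instance] Matrix.frobeniusNormedAddCommGroup in
lemma frobNorm_add_le (M M' : Matrix (Fin m) (Fin n) ℝ) :
    frobNorm (M + M') ≤ frobNorm M + frobNorm M' := by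
  simp only [frobNorm_eq_norm]
  exact norm_add_le M M'

lemma toEuc_apply (v : Fin n → ℝ) (i : Fin n) : toEuc v i = v i := rfl

lemma norm_toEuc_mulVec_le (M : Matrix (Fin m) (Fin n) ℝ) (x : EuclideanSpace ℝ (Fin n)) :
    ‖toEuc (M.mulVec x)‖ ≤ frobNorm M * ‖x‖ := by
  refine le_of_pow_le_pow_left₀ two_ne_zero (mul_nonneg (frobNorm_nonneg M) (norm_nonneg x)) ?_
  rw [mul_pow, frobNorm_sq, EuclideanSpace.real_norm_sq_eq, EuclideanSpace.real_norm_sq_eq,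
    Finset.sum_mul]
  exact Finset.sum_le_sum fun i _ => Finset.sum_mul_sq_le_sq_mul_sq Finset.univ (M i) x

lemma norm_toEuc_mulVec_eq_zero {M : Matrix (Fin m) (Fin n) ℝ} (hM : frobNorm M = 0)
    (x : EuclideanSpace ℝ (Fin n)) : ‖toEuc (M.mulVec x)‖ = 0 :=
  le_antisymm ((norm_toEuc_mulVec_le M x).trans_eq (by rw [hM, zero_mul])) (norm_nonneg _)

/-- Matrix of a continuous linear map in the standard bases. -/
noncomputable def stdMatrix (A : EuclideanSpace ℝ (Fin m) →L[ℝ] EuclideanSpace ℝ (Fin l)) :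
    Matrix (Fin l) (Fin m) ℝ :=
  fun i j => A (EuclideanSpace.single j 1) i

lemma jacMat_eq_stdMatrix (F : EuclideanSpace ℝ (Fin m) → EuclideanSpace ℝ (Fin l))
    (y : EuclideanSpace ℝ (Fin m)) : jacMat F y = stdMatrix (fderiv ℝ F y) := rfl

lemma stdMatrix_sub (A B : EuclideanSpace ℝ (Fin m) →L[ℝ] EuclideanSpace ℝ (Fin l)) :
    stdMatrix (A - B) = stdMatrix A - stdMatrix B := by
  ext i j
  simp [stdMatrix]

lemma toEuc_stdMatrix_mulVec (A : EuclideanSpace ℝ (Fin m) →L[ℝ] EuclideanSpace ℝ (Fin l))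
    (v : Fin m → ℝ) : toEuc ((stdMatrix A).mulVec v) = A (toEuc v) := by
  have hv : toEuc v = ∑ j, v j • EuclideanSpace.single j (1 : ℝ) := by
    ext i
    simp [toEuc_apply, Pi.single_apply]
  ext i
  rw [hv, map_sum]
  simp [toEuc_apply, Matrix.mulVec, dotProduct, stdMatrix, mul_comm]

lemma frobNorm_stdMatrix_mul_le
    (A : EuclideanSpace ℝ (Fin m) →L[ℝ] EuclideanSpace ℝ (Fin l))
    (M : Matrix (Fin m) (Fin n) ℝ) :
    frobNorm (stdMatrix A * M) ≤ ‖A‖ * frobNorm M := by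
  refine le_of_pow_le_pow_left₀ two_ne_zero (mul_nonneg (norm_nonneg A) (frobNorm_nonneg M)) ?_
  rw [mul_pow, frobNorm_sq, frobNorm_sq, Finset.sum_comm,
    Finset.sum_comm (s := (Finset.univ : Finset (Fin m))), Finset.mul_sum]
  refine Finset.sum_le_sum fun j _ => ?_
  have h := pow_le_pow_left₀ (norm_nonneg _) (A.le_opNorm (toEuc fun k => M k j)) 2
  rw [← toEuc_stdMatrix_mulVec, mul_pow, EuclideanSpace.real_norm_sq_eq,
    EuclideanSpace.real_norm_sq_eq] at h
  exact h

end Frobenius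

section Taylor

variable {E E' : Type*} [NormedAddCommGroup E] [NormedSpace ℝ E] [NormedAddCommGroup E']
  [NormedSpace ℝ E'] {F : E → E'} {C₁ C₂ β : ℝ}

/-- A bounded Lipschitz derivative is `β`-Hölder for every `β ∈ [0,1]`. -/
lemma norm_fderiv_sub_le_rpow (hF : ContDiff ℝ 2 F) (h₁ : ∀ x, ‖fderiv ℝ F x‖ ≤ C₁)
    (h₂ : ∀ x, ‖fderiv ℝ (fderiv ℝ F) x‖ ≤ C₂) (hβ0 : 0 ≤ β) (hβ1 : β ≤ 1) (x y : E) :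
    ‖fderiv ℝ F y - fderiv ℝ F x‖ ≤ 2 * (C₁ + C₂) * ‖y - x‖ ^ β := by
  have hC₁ : 0 ≤ C₁ := (norm_nonneg _).trans (h₁ x)
  have hC₂ : 0 ≤ C₂ := (norm_nonneg (fderiv ℝ (fderiv ℝ F) x)).trans (h₂ x)
  have hp : 0 ≤ ‖y - x‖ ^ β := Real.rpow_nonneg (norm_nonneg _) _
  rcases le_total ‖y - x‖ 1 with h | h
  · have hd : Differentiable ℝ (fderiv ℝ F) :=
      (hF.fderiv_right (m := 1) (by norm_num)).differentiable (by norm_num)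
    have hlip : ‖fderiv ℝ F y - fderiv ℝ F x‖ ≤ C₂ * ‖y - x‖ :=
      convex_univ.norm_image_sub_le_of_norm_fderiv_le (𝕜 := ℝ) (fun z _ => hd z)
        (fun z _ => h₂ z) (Set.mem_univ x) (Set.mem_univ y)
    have hle : ‖y - x‖ ≤ ‖y - x‖ ^ β := Real.self_le_rpow_of_le_one (norm_nonneg _) h hβ1
    nlinarith [mul_le_mul_of_nonneg_left hle hC₂, mul_nonneg hC₁ hp, mul_nonneg hC₂ hp]
  · have hle : 1 ≤ ‖y - x‖ ^ β := Real.one_le_rpow h hβ0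
    have := norm_sub_le (fderiv ℝ F y) (fderiv ℝ F x)
    nlinarith [h₁ x, h₁ y, mul_le_mul_of_nonneg_left hle hC₁, mul_nonneg hC₂ hp]

lemma norm_taylor_sub_le_rpow (hF : ContDiff ℝ 2 F) (h₁ : ∀ x, ‖fderiv ℝ F x‖ ≤ C₁)
    (h₂ : ∀ x, ‖fderiv ℝ (fderiv ℝ F) x‖ ≤ C₂) (hβ0 : 0 ≤ β) (hβ1 : β ≤ 1) (x w : E) :
    ‖F (x + w) - F x - fderiv ℝ F x w‖ ≤ 2 * (C₁ + C₂) * ‖w‖ ^ β * ‖w‖ := by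
  have hC₁ : 0 ≤ C₁ := (norm_nonneg _).trans (h₁ x)
  have hC₂ : 0 ≤ C₂ := (norm_nonneg (fderiv ℝ (fderiv ℝ F) x)).trans (h₂ x)
  have hd : Differentiable ℝ F := hF.differentiable (by norm_num)
  have key := (convex_closedBall x ‖w‖).norm_image_sub_le_of_norm_fderiv_le' (𝕜 := ℝ)
    (f := F) (φ := fderiv ℝ F x) (C := 2 * (C₁ + C₂) * ‖w‖ ^ β) (x := x) (y := x + w)
    (fun z _ => hd z)
    (fun z hz => (norm_fderiv_sub_le_rpow hF h₁ h₂ hβ0 hβ1 x z).trans (by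
      have : ‖z - x‖ ≤ ‖w‖ := by simpa [dist_eq_norm] using hz
      gcongr))
    (by simp) (by simp)
  simpa using key

end Taylor

section Composition

variable {d₀ n₀ n₁ : ℕ} {F : EuclideanSpace ℝ (Fin n₀) → EuclideanSpace ℝ (Fin n₁)}
  {C₁ C₂ α γ β J K G : ℝ}

lemma rpow_mul_self_le {w h : ℝ} (hw : 0 ≤ w) (hK : 0 ≤ K) (hG : 0 ≤ G) (hh : 0 < h)
    (hh1 : h ≤ 1) (hβ0 : 0 ≤ β) (hβαγ : γ ≤ β * α + α) (hwle : w ≤ K * G * h ^ α) :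
    w ^ β * w ≤ K * G * (G ^ β * K ^ β) * h ^ γ := by
  calc w ^ β * w ≤ (K * G * h ^ α) ^ β * (K * G * h ^ α) := by gcongr
    _ = K * G * (G ^ β * K ^ β) * h ^ (β * α + α) := by
        rw [Real.mul_rpow (by positivity) (by positivity), Real.mul_rpow hK hG,
          ← Real.rpow_mul hh.le, Real.rpow_add hh, mul_comm β α]
        ring
    _ ≤ K * G * (G ^ β * K ^ β) * h ^ γ := by
        gcongr ?_ * ?_
        exact Real.rpow_le_rpow_of_exponent_ge hh hh1 hβαγ

lemma rpow_increment_le {x h : ℝ} (hx : 0 ≤ x) (hJ : 0 ≤ J) (hK : 0 ≤ K) (hG : 0 ≤ G)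
    (hh : 0 < h) (hh1 : h ≤ 1) (hβ0 : 0 ≤ β) (hβ1 : β ≤ 1) (hαγ : α ≤ γ)
    (hβαγ : γ ≤ β * α + α) (hxle : x ≤ J * h ^ γ + K * G * h ^ α) :
    x ^ β ≤ (J ^ β + G ^ β * K ^ β) * h ^ (γ - α) := by
  have h1 : x ≤ (J + K * G) * h ^ α := by
    have : h ^ γ ≤ h ^ α := Real.rpow_le_rpow_of_exponent_ge hh hh1 hαγ
    nlinarith [mul_le_mul_of_nonneg_left this hJ]
  calc x ^ β ≤ ((J + K * G) * h ^ α) ^ β := by gcongr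
    _ = (J + K * G) ^ β * h ^ (β * α) := by
        rw [Real.mul_rpow (by positivity) (by positivity), ← Real.rpow_mul hh.le, mul_comm β α]
    _ ≤ (J ^ β + (K * G) ^ β) * h ^ (γ - α) := by
        gcongr ?_ * ?_
        · exact Real.rpow_add_le_add_rpow hJ (by positivity) hβ0 hβ1
        · exact Real.rpow_le_rpow_of_exponent_ge hh hh1 (by linarith)
    _ = _ := by rw [Real.mul_rpow hK hG, mul_comm (K ^ β)]

lemma norm_comp_remainder_le (hF : ContDiff ℝ 2 F) (h₁ : ∀ x, ‖fderiv ℝ F x‖ ≤ C₁)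
    (h₂ : ∀ x, ‖fderiv ℝ (fderiv ℝ F) x‖ ≤ C₂) (hK : 0 ≤ K) (hG : 0 ≤ G)
    (hβ0 : 0 ≤ β) (hβ1 : β ≤ 1) (hβαγ : γ ≤ β * α + α) {h : ℝ} (hh : 0 < h) (hh1 : h ≤ 1)
    {x y : EuclideanSpace ℝ (Fin n₀)} {M : Matrix (Fin n₀) (Fin d₀) ℝ} {z : Fin d₀ → ℝ}
    (hR : ‖y - x - toEuc (M.mulVec z)‖ ≤ J * h ^ γ)
    (hw : ‖toEuc (M.mulVec z)‖ ≤ K * G * h ^ α) :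
    ‖F y - F x - toEuc ((jacMat F x * M).mulVec z)‖ ≤
      (C₁ * J + 2 * (C₁ + C₂) * (K * G * (G ^ β * K ^ β))) * h ^ γ := by
  have hC₁ : 0 ≤ C₁ := (norm_nonneg _).trans (h₁ x)
  have hC₂ : 0 ≤ C₂ := (norm_nonneg (fderiv ℝ (fderiv ℝ F) x)).trans (h₂ x)
  rw [← Matrix.mulVec_mulVec, jacMat_eq_stdMatrix, toEuc_stdMatrix_mulVec]
  set w := toEuc (M.mulVec z)
  have hlip : ‖F y - F (x + w)‖ ≤ C₁ * ‖y - (x + w)‖ :=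
    convex_univ.norm_image_sub_le_of_norm_fderiv_le (𝕜 := ℝ)
      (fun z _ => hF.differentiable (by norm_num) z)
      (fun z _ => h₁ z) (Set.mem_univ _) (Set.mem_univ _)
  rw [← sub_sub] at hlip
  have htaylor := norm_taylor_sub_le_rpow hF h₁ h₂ hβ0 hβ1 x w
  have hpow := rpow_mul_self_le (norm_nonneg w) hK hG hh hh1 hβ0 hβαγ hw
  calc ‖F y - F x - fderiv ℝ F x w‖
      = ‖(F y - F (x + w)) + (F (x + w) - F x - fderiv ℝ F x w)‖ := by congr 1; abel
    _ ≤ C₁ * (J * h ^ γ) + 2 * (C₁ + C₂) * (K * G * (G ^ β * K ^ β) * h ^ γ) := by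
        refine (norm_add_le _ _).trans (add_le_add (hlip.trans (by gcongr)) ?_)
        rw [mul_assoc] at htaylor
        exact htaylor.trans (by gcongr)
    _ = _ := by ring

lemma frobNorm_jacMat_mul_sub_le (hF : ContDiff ℝ 2 F) (h₁ : ∀ x, ‖fderiv ℝ F x‖ ≤ C₁)
    (h₂ : ∀ x, ‖fderiv ℝ (fderiv ℝ F) x‖ ≤ C₂) (hJ : 0 ≤ J) (hK : 0 ≤ K) (hG : 0 ≤ G)
    (hβ0 : 0 ≤ β) (hβ1 : β ≤ 1) (hαγ : α ≤ γ) (hβαγ : γ ≤ β * α + α) {h : ℝ} (hh : 0 < h)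
    (hh1 : h ≤ 1) {x y : EuclideanSpace ℝ (Fin n₀)} {M M' : Matrix (Fin n₀) (Fin d₀) ℝ}
    {z : Fin d₀ → ℝ} (hM : frobNorm M ≤ K)
    (hR : ‖y - x - toEuc (M.mulVec z)‖ ≤ J * h ^ γ)
    (hw : ‖toEuc (M.mulVec z)‖ ≤ K * G * h ^ α)
    {J' : ℝ} (hMM' : frobNorm (M' - M) ≤ J' * h ^ (γ - α)) :
    frobNorm (jacMat F y * M' - jacMat F x * M) ≤
      (C₁ * J' + 2 * (C₁ + C₂) * (K * (J ^ β + G ^ β * K ^ β))) * h ^ (γ - α) := by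
  have hC₁ : 0 ≤ C₁ := (norm_nonneg _).trans (h₁ x)
  have hC₂ : 0 ≤ C₂ := (norm_nonneg (fderiv ℝ (fderiv ℝ F) x)).trans (h₂ x)
  have hxy : ‖y - x‖ ≤ J * h ^ γ + K * G * h ^ α := by
    refine le_trans ?_ (add_le_add hR hw)
    simpa using norm_add_le (y - x - toEuc (M.mulVec z)) (toEuc (M.mulVec z))
  have hpow := rpow_increment_le (norm_nonneg _) hJ hK hG hh hh1 hβ0 hβ1 hαγ hβαγ hxy
  have hD : ‖fderiv ℝ F y - fderiv ℝ F x‖ ≤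
      2 * (C₁ + C₂) * ((J ^ β + G ^ β * K ^ β) * h ^ (γ - α)) :=
    (norm_fderiv_sub_le_rpow hF h₁ h₂ hβ0 hβ1 x y).trans (by gcongr)
  calc frobNorm (jacMat F y * M' - jacMat F x * M)
      = frobNorm (stdMatrix (fderiv ℝ F y) * (M' - M) +
          stdMatrix (fderiv ℝ F y - fderiv ℝ F x) * M) := by
        rw [stdMatrix_sub, jacMat_eq_stdMatrix, jacMat_eq_stdMatrix, Matrix.mul_sub,
          Matrix.sub_mul]
        congr 1
        abel
    _ ≤ C₁ * (J' * h ^ (γ - α)) +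
          2 * (C₁ + C₂) * ((J ^ β + G ^ β * K ^ β) * h ^ (γ - α)) * K := by
        refine (frobNorm_add_le _ _).trans (add_le_add ?_ ?_)
        · exact (frobNorm_stdMatrix_mul_le _ _).trans
            (mul_le_mul (h₁ y) hMM' (frobNorm_nonneg _) hC₁)
        · exact (frobNorm_stdMatrix_mul_le _ _).trans
            (mul_le_mul hD hM (frobNorm_nonneg _) ((norm_nonneg _).trans hD))
    _ = _ := by ring

end Composition

section Seminorms

lemma le_toReal_mul_of_ofReal_div_le {S : ℝ≥0∞} {a b : ℝ} (hS : S ≠ ∞) (hb : 0 < b)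
    (h : ENNReal.ofReal (a / b) ≤ S) : a ≤ S.toReal * b :=
  (div_le_iff₀ hb).1 ((ENNReal.ofReal_le_iff_le_toReal hS).1 h)

/-- The exponent `0 < δ` and the bound `t - s ≤ 1` make a path with finite Hölder seminorm
bounded. -/
lemma supNormMat_ne_top {m n : ℕ} {δ s t : ℝ} {M : ℝ → Matrix (Fin m) (Fin n) ℝ} (hδ : 0 < δ)
    (hts : t - s ≤ 1) (hM : holderSemiMat δ M s t ≠ ∞) : supNormMat M s t ≠ ∞ := by
  refine ne_top_of_le_ne_top
    (ENNReal.ofReal_ne_top (r := (holderSemiMat δ M s t).toReal + frobNorm (M s)))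
    (iSup₂_le fun r hr => ENNReal.ofReal_le_ofReal ?_)
  rcases hr.1.eq_or_lt with rfl | hsr
  · simp
  · have h1 : frobNorm (M r - M s) ≤ (holderSemiMat δ M s t).toReal * (r - s) ^ δ :=
      le_toReal_mul_of_ofReal_div_le hM (Real.rpow_pos_of_pos (sub_pos.2 hsr) _)
        (le_iSup_of_le s <| le_iSup_of_le r <| le_iSup_of_le ⟨le_rfl, hsr, hr.2⟩ le_rfl)
    have h2 : (r - s) ^ δ ≤ 1 :=
      Real.rpow_le_one (sub_nonneg.2 hr.1) (by linarith [hr.2]) hδ.le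
    have h3 := frobNorm_add_le (M r - M s) (M s)
    rw [sub_add_cancel] at h3
    nlinarith [mul_le_mul_of_nonneg_left h2 (holderSemiMat δ M s t).toReal_nonneg]

/-- Version of the composition estimate with real constants; the Hölder bound on `g` enters only
through the increments `f' u (g v - g u)`. -/
lemma ctrlSemi_comp_le {d₀ n₀ n₁ : ℕ} {F : EuclideanSpace ℝ (Fin n₀) → EuclideanSpace ℝ (Fin n₁)}
    {C₁ C₂ α γ β J K G s t : ℝ} {g : ℝ → EuclideanSpace ℝ (Fin d₀)}
    {f : ℝ → EuclideanSpace ℝ (Fin n₀)} {f' : ℝ → Matrix (Fin n₀) (Fin d₀) ℝ}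
    (hF : ContDiff ℝ 2 F) (h₁ : ∀ x, ‖fderiv ℝ F x‖ ≤ C₁)
    (h₂ : ∀ x, ‖fderiv ℝ (fderiv ℝ F) x‖ ≤ C₂) (hJ : 0 ≤ J) (hK : 0 ≤ K) (hG : 0 ≤ G)
    (hβ0 : 0 ≤ β) (hβ1 : β ≤ 1) (hαγ : α ≤ γ) (hβαγ : γ ≤ β * α + α) (hts : t - s ≤ 1)
    (hf' : ∀ u ∈ Set.Icc s t, frobNorm (f' u) ≤ K)
    (hR : ∀ u v, s ≤ u → u < v → v ≤ t →
      ‖f v - f u - toEuc ((f' u).mulVec (g v - g u))‖ ≤ J * (v - u) ^ γ)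
    (hw : ∀ u v, s ≤ u → u < v → v ≤ t →
      ‖toEuc ((f' u).mulVec (g v - g u))‖ ≤ K * G * (v - u) ^ α)
    (hH : ∀ u v, s ≤ u → u < v → v ≤ t → frobNorm (f' v - f' u) ≤ J * (v - u) ^ (γ - α)) :
    ctrlSemi γ α g (fun x => F (f x)) (fun x => jacMat F (f x) * f' x) s t ≤
      ENNReal.ofReal (2 * C₁ * J +
        2 * (C₁ + C₂) * (K * (1 + G) * (J ^ β + G ^ β * K ^ β))) := by
  have hC₁ : 0 ≤ C₁ := (norm_nonneg _).trans (h₁ 0)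
  have hC₂ : 0 ≤ C₂ := (norm_nonneg (fderiv ℝ (fderiv ℝ F) 0)).trans (h₂ 0)
  calc ctrlSemi γ α g (fun x => F (f x)) (fun x => jacMat F (f x) * f' x) s t
      ≤ ENNReal.ofReal (C₁ * J + 2 * (C₁ + C₂) * (K * G * (G ^ β * K ^ β))) +
        ENNReal.ofReal (C₁ * J + 2 * (C₁ + C₂) * (K * (J ^ β + G ^ β * K ^ β))) := by
        refine add_le_add ?_ ?_ <;>
        · refine iSup_le fun u => iSup_le fun v => iSup_le fun ⟨hsu, huv, hvt⟩ =>
            ENNReal.ofReal_le_ofReal ((div_le_iff₀ (Real.rpow_pos_of_pos (sub_pos.2 huv) _)).2 ?_)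
          first
          | exact norm_comp_remainder_le hF h₁ h₂ hK hG hβ0 hβ1 hβαγ (sub_pos.2 huv)
              (by linarith) (hR u v hsu huv hvt) (hw u v hsu huv hvt)
          | exact frobNorm_jacMat_mul_sub_le hF h₁ h₂ hJ hK hG hβ0 hβ1 hαγ hβαγ (sub_pos.2 huv)
              (by linarith) (hf' u ⟨hsu, huv.le.trans hvt⟩) (hR u v hsu huv hvt)
              (hw u v hsu huv hvt) (hH u v hsu huv hvt)
    _ ≤ _ := by
        rw [← ENNReal.ofReal_add (by positivity) (by positivity)]
        refine ENNReal.ofReal_le_ofReal ?_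
        have : 0 ≤ 2 * (C₁ + C₂) * (K * G * J ^ β) := by positivity
        linarith

lemma ofReal_composition_bound {A B β : ℝ} {J K G : ℝ≥0∞} (hA : 0 ≤ A) (hB : 0 ≤ B)
    (hJ : J ≠ ∞) (hK : K ≠ ∞) (hG : G ≠ ∞) (hβ : 0 ≤ β) :
    ENNReal.ofReal (A * (1 + K.toReal) * J.toReal + B * K.toReal * (1 + G.toReal) *
        (J.toReal ^ β + G.toReal ^ β * K.toReal ^ β)) =
      ENNReal.ofReal A * (1 + K) * J + ENNReal.ofReal B * K * (1 + G) *
        (J ^ β + G ^ β * K ^ β) := by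
  lift J to NNReal using hJ
  lift K to NNReal using hK
  lift G to NNReal using hG
  lift A to NNReal using hA
  lift B to NNReal using hB
  simp only [ENNReal.coe_toReal, ENNReal.ofReal_coe_nnreal, ← ENNReal.coe_rpow_of_nonneg _ hβ]
  norm_cast
  exact ENNReal.ofReal_coe_nnreal

end Seminorms

/-- Quadratic growth bound for composition of a controlled path with a `C²`
function (estimate `eq:quadratic-controled-estimate`): if `β ∈ [0,1]` satisfies
`βα + α ≥ γ`, then
`[(F(f), ∇F(f)f')]_{D^γ_g([s,t])}
  ≤ N ‖F‖_{C¹} (1 + ‖f'‖_{C⁰}) [(f,f')]_{D^γ_g}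
    + N ‖F‖_{C²} ‖f'‖_{C⁰} (1 + [g]_{C^α}) ([(f,f')]_{D^γ_g}^β + [g]_{C^α}^β ‖f'‖_{C⁰}^β)`,
where `‖F‖_{C¹} = sup|F| + sup‖DF‖` and `‖F‖_{C²} = ‖F‖_{C¹} + sup‖D²F‖`. -/
theorem ctrl_composition_quadratic_bound
    (α γ β : ℝ) (hα : 1 / 3 < α ∧ α ≤ 1 / 2) (hγ : α < γ ∧ γ ≤ 2 * α)
    (hβ : 0 ≤ β ∧ β ≤ 1) (hβαγ : β * α + α ≥ γ) :
    ∃ N : ℝ, 0 < N ∧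
      ∀ (d₀ n₀ n₁ : ℕ)
        (F : EuclideanSpace ℝ (Fin n₀) → EuclideanSpace ℝ (Fin n₁))
        (CF0 CF1 CF2 : ℝ),
        ContDiff ℝ 2 F →
        (∀ x, ‖F x‖ ≤ CF0) →
        (∀ x, ‖fderiv ℝ F x‖ ≤ CF1) →
        (∀ x, ‖fderiv ℝ (fderiv ℝ F) x‖ ≤ CF2) →
      ∀ (g : ℝ → EuclideanSpace ℝ (Fin d₀)) (f : ℝ → EuclideanSpace ℝ (Fin n₀))
        (f' : ℝ → Matrix (Fin n₀) (Fin d₀) ℝ) (s t : ℝ),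
        0 ≤ s → s ≤ t → t ≤ 1 →
        -- `(f, f')` has finite controlled seminorm on `[s,t]`
        ctrlSemi γ α g f f' s t ≠ ∞ →
        ctrlSemi γ α g (fun x => F (f x)) (fun x => jacMat F (f x) * f' x) s t
          ≤ ENNReal.ofReal (N * (CF0 + CF1)) * (1 + supNormMat f' s t)
              * ctrlSemi γ α g f f' s t
            + ENNReal.ofReal (N * (CF0 + CF1 + CF2)) * supNormMat f' s t
              * (1 + holderSemiE α g s t)
              * ((ctrlSemi γ α g f f' s t) ^ β
                  + (holderSemiE α g s t) ^ β * (supNormMat f' s t) ^ β) := by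
  refine ⟨2, two_pos, ?_⟩
  intro d₀ n₀ n₁ F CF0 CF1 CF2 hF h₀ h₁ h₂ g f f' s t hs hst ht hfin
  have hβ0 : 0 < β := by nlinarith
  have hC₀ : 0 ≤ CF0 := (norm_nonneg _).trans (h₀ 0)
  have hC₁ : 0 ≤ CF1 := (norm_nonneg _).trans (h₁ 0)
  have hC₂ : 0 ≤ CF2 := (norm_nonneg (fderiv ℝ (fderiv ℝ F) 0)).trans (h₂ 0)
  have hts : t - s ≤ 1 := by linarith
  have hKfin : supNormMat f' s t ≠ ∞ :=
    supNormMat_ne_top (sub_pos.2 hγ.1) hts (ne_top_of_le_ne_top hfin le_add_self)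
  have hf' : ∀ u ∈ Set.Icc s t, frobNorm (f' u) ≤ (supNormMat f' s t).toReal := fun u hu =>
    (ENNReal.ofReal_le_iff_le_toReal hKfin).1 (le_iSup₂_of_le u hu le_rfl)
  have hR : ∀ u v, s ≤ u → u < v → v ≤ t →
      ‖f v - f u - toEuc ((f' u).mulVec (g v - g u))‖ ≤
        (ctrlSemi γ α g f f' s t).toReal * (v - u) ^ γ := fun u v hsu huv hvt =>
    le_toReal_mul_of_ofReal_div_le hfin (Real.rpow_pos_of_pos (sub_pos.2 huv) _)
      (le_add_right <| le_iSup_of_le u <| le_iSup_of_le v <|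
        le_iSup_of_le ⟨hsu, huv, hvt⟩ le_rfl)
  have hH : ∀ u v, s ≤ u → u < v → v ≤ t →
      frobNorm (f' v - f' u) ≤
        (ctrlSemi γ α g f f' s t).toReal * (v - u) ^ (γ - α) := fun u v hsu huv hvt =>
    le_toReal_mul_of_ofReal_div_le hfin (Real.rpow_pos_of_pos (sub_pos.2 huv) _)
      (le_add_left <| le_iSup_of_le u <| le_iSup_of_le v <|
        le_iSup_of_le ⟨hsu, huv, hvt⟩ le_rfl)
  have main := fun G hG hw => ctrlSemi_comp_le (G := G) hF h₁ h₂ ENNReal.toReal_nonneg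
    ENNReal.toReal_nonneg hG hβ0.le hβ.2 hγ.1.le hβαγ hts hf' hR hw hH
  generalize ctrlSemi γ α g f f' s t = J at *
  by_cases hK : supNormMat f' s t = 0
  · have := main 0 le_rfl fun u v hsu huv hvt => by
      have hu : frobNorm (f' u) = 0 :=
        le_antisymm ((hf' u ⟨hsu, huv.le.trans hvt⟩).trans_eq (by simp [hK])) (frobNorm_nonneg _)
      simp [norm_toEuc_mulVec_eq_zero hu]
    refine this.trans ?_
    simp only [hK, ENNReal.toReal_zero, zero_mul, mul_zero, add_zero, mul_one]
    rw [ENNReal.ofReal_mul (by positivity), ENNReal.ofReal_toReal hfin]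
    gcongr
    linarith
  by_cases hGfin : holderSemiE α g s t = ∞
  · rcases (add_nonneg (add_nonneg hC₀ hC₁) hC₂).eq_or_lt with hC | hC
    · have hF0 : F = fun _ => 0 :=
        funext fun x => norm_le_zero_iff.1 ((h₀ x).trans (by linarith))
      subst hF0
      have hjac : ∀ x, jacMat (fun _ : EuclideanSpace ℝ (Fin n₀) =>
          (0 : EuclideanSpace ℝ (Fin n₁))) x = 0 := fun x => by
        ext i j
        simp [jacMat]
      simp [ctrlSemi, holderSemiMat, hjac, frobNorm, toEuc]
    · refine le_top.trans_eq (Eq.symm ?_)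
      have hKβ : supNormMat f' s t ^ β ≠ 0 := by
        simp [ENNReal.rpow_eq_zero_iff, hK, hβ0.not_gt, hKfin]
      have hN : ENNReal.ofReal (2 * (CF0 + CF1 + CF2)) ≠ 0 := by
        simpa using hC
      rw [hGfin, ENNReal.top_rpow_of_pos hβ0, ENNReal.top_mul hKβ, add_top, add_top,
        ENNReal.mul_top (mul_ne_zero hN hK), ENNReal.top_mul_top, add_top]
  have hw : ∀ u v, s ≤ u → u < v → v ≤ t → ‖toEuc ((f' u).mulVec (g v - g u))‖ ≤
      (supNormMat f' s t).toReal * (holderSemiE α g s t).toReal * (v - u) ^ α := by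
    intro u v hsu huv hvt
    refine (norm_toEuc_mulVec_le _ _).trans ?_
    rw [mul_assoc]
    exact mul_le_mul (hf' u ⟨hsu, huv.le.trans hvt⟩)
      (le_toReal_mul_of_ofReal_div_le hGfin (Real.rpow_pos_of_pos (sub_pos.2 huv) _)
        (le_iSup_of_le u <| le_iSup_of_le v <| le_iSup_of_le ⟨hsu, huv, hvt⟩ le_rfl))
      (norm_nonneg _) ENNReal.toReal_nonneg
  refine (main _ ENNReal.toReal_nonneg hw).trans ?_
  rw [← ofReal_composition_bound (by positivity) (by positivity) hfin hKfin hGfin hβ0.le]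
  refine ENNReal.ofReal_le_ofReal (add_le_add ?_ ?_)
  · have hJ := J.toReal_nonneg
    have hKJ : 0 ≤ (supNormMat f' s t).toReal * J.toReal := by positivity
    nlinarith [mul_nonneg hC₀ hJ, mul_nonneg hC₀ hKJ, mul_nonneg hC₁ hKJ]
  · rw [mul_assoc (2 * (CF0 + CF1 + CF2)), mul_assoc (2 * (CF0 + CF1 + CF2))]
    gcongr
    linarith
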